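/- arXiv:2401.00937 — 3 statements merged into one kernel-verified Lean document; each statement's English description precedes it below -/
import Mathlib

section
/- Every Ψ ∈ Conf(B⁴₊) satisfies either Ψ(B³) = B³ (and then Ψ(S³₊) = S³₊) or Ψ(B³) = S³₊. The subset Conf⁺(B⁴₊) := {Ψ ∈ Conf(B⁴₊) : Ψ(B³) = B³} is a normal subgroup of Conf(B⁴₊); the map Λ belongs to Conf(B⁴₊) but not to Conf⁺(B⁴₊); and the map (Φ, n) ↦ Φ∘Λⁿ from Conf⁺(B⁴₊) × {0,1} to Conf(B⁴₊) is a bijection. Consequently Conf⁺(B⁴₊) has index 2 in Conf(B⁴₊) and Conf(B⁴₊) is the internal semidirect product of Conf⁺(B⁴₊) with the order-two subgroup generated by Λ. -/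
noncomputable section

open Real Set
open scoped RealInnerProductSpace Topology

abbrev E4 := EuclideanSpace ℝ (Fin 4)

def e4 (i : Fin 4) : E4 := EuclideanSpace.single i 1

/-- Euclidean Laplacian on `ℝ⁴`. -/
def lap (u : E4 → ℝ) (x : E4) : ℝ :=
  ∑ i : Fin 4, fderiv ℝ (fun y => fderiv ℝ u y (e4 i)) x (e4 i)

/-- Laplacian in the first three variables. -/
def lap3 (u : E4 → ℝ) (x : E4) : ℝ :=
  ∑ i : Fin 3, fderiv ℝ (fun y => fderiv ℝ u y (e4 i.castSucc)) x (e4 i.castSucc)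

/-- Spherical Laplacian of (the restriction to `S³` of) `f`, via the `0`-homogeneous
extension `y ↦ f (y / ‖y‖)`. -/
def sphLap (f : E4 → ℝ) (x : E4) : ℝ := lap (fun y => f (‖y‖⁻¹ • y)) x

/-- Inward normal derivative at a point of the unit sphere: `μ_M u x = -⟨∇u x, x⟩`. -/
def muM (u : E4 → ℝ) (x : E4) : ℝ := -(fderiv ℝ u x x)

/-- Inward normal derivative at a point of the flat boundary `B³ ⊂ {x₄ = 0}`. -/
def muN (u : E4 → ℝ) (x : E4) : ℝ := fderiv ℝ u x (e4 3)

/-- At `p ∈ Σ`, `ν_M f p = -(d/dφ)|_{φ = π/2} f(sin φ • σ, cos φ)`. -/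
def nuM (f : E4 → ℝ) (p : E4) : ℝ :=
  -(deriv (fun t : ℝ => f (Real.sin t • p + Real.cos t • e4 3)) (π/2))

/-- At `p ∈ Σ`, `ν_N f p = -(d/dr)|_{r = 1} f (r • p)`. -/
def nuN (f : E4 → ℝ) (p : E4) : ℝ := -(deriv (fun r : ℝ => f (r • p)) 1)

/-- The closed upper half-ball `B⁴₊`. -/
def B4p : Set E4 := {x | ‖x‖ ≤ 1 ∧ 0 ≤ x 3}
/-- The upper half-sphere `M = S³₊`. -/
def Mhs : Set E4 := {x | ‖x‖ = 1 ∧ 0 ≤ x 3}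
/-- The flat boundary `N = B³`. -/
def Nfb : Set E4 := {x | ‖x‖ ≤ 1 ∧ x 3 = 0}
/-- The corner `Σ = S²`. -/
def Sig : Set E4 := {x | ‖x‖ = 1 ∧ x 3 = 0}

/-- `P₃^M u = (1/2) μ_M (Δu) + Δ_{S³}(μ_M u) - Δ_{S³}(u|_M)`. -/
def P3M (u : E4 → ℝ) (x : E4) : ℝ :=
  (1/2) * muM (lap u) x + sphLap (muM u) x - sphLap u x

/-- `P₃^N u = (1/2) μ_N (Δu) + Δ_{ℝ³}(μ_N u)`. -/
def P3N (u : E4 → ℝ) (x : E4) : ℝ :=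
  (1/2) * muN (lap u) x + lap3 (muN u) x


/-- The denominator `x₁² + x₂² + x₃² + (x₄+1)²`. -/
def Dden (x : E4) : ℝ := (x 0) ^ 2 + (x 1) ^ 2 + (x 2) ^ 2 + (x 3 + 1) ^ 2

/-- The conformal inversion `Λ(x) = (2x₁, 2x₂, 2x₃, 1 - ‖x‖²) / (x₁²+x₂²+x₃²+(x₄+1)²)`
of the half-ball, interchanging `M` and `N` and fixing `Σ` pointwise. -/
def Lam (x : E4) : E4 :=
  (Dden x)⁻¹ • ((2 : ℝ) • x + (1 - ‖x‖ ^ 2 - 2 * x 3) • e4 3)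

/-- `F` is the restriction to `B⁴₊` of a smooth map on an open neighborhood. -/
def SmoothNearHB (F : E4 → E4) : Prop :=
  ∃ U : Set E4, IsOpen U ∧ B4p ⊆ U ∧ ContDiffOn ℝ (⊤ : ℕ∞) F U

/-- Membership in the conformal group `Conf(B⁴₊)`: `F` restricts to a bijection of the
closed half-ball, `F` and an inverse `G` of it are restrictions of smooth maps on open
neighborhoods of `B⁴₊`, `F` maps `S³₊ ∪ B³` onto itself and `Σ` onto itself, and the
derivative of `F` is a conformal linear map at every point of `B⁴₊`. -/
def ConfMem (F : E4 → E4) : Prop :=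
  Set.BijOn F B4p B4p ∧ SmoothNearHB F ∧
  (∃ G : E4 → E4, SmoothNearHB G ∧ Set.BijOn G B4p B4p ∧
    Set.EqOn (G ∘ F) id B4p ∧ Set.EqOn (F ∘ G) id B4p) ∧
  F '' (Mhs ∪ Nfb) = Mhs ∪ Nfb ∧ F '' Sig = Sig ∧
  (∀ x ∈ B4p, ∃ lam : ℝ, 0 < lam ∧ ∀ v : E4, ‖fderiv ℝ F x v‖ = lam * ‖v‖)

/-- Membership in `Conf⁺(B⁴₊)`, the elements fixing `B³` as a set. -/
def ConfPlusMem (F : E4 → E4) : Prop := ConfMem F ∧ F '' Nfb = Nfb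

lemma norm_sq_e4 (x : E4) : ‖x‖ ^ 2 = x 0 ^ 2 + x 1 ^ 2 + x 2 ^ 2 + x 3 ^ 2 := by
  simp [EuclideanSpace.norm_sq_eq, Fin.sum_univ_four]

/-! ### The inversion `Lam` -/

lemma Dden_eq (x : E4) : Dden x = ‖x‖ ^ 2 + 2 * x 3 + 1 := by
  rw [norm_sq_e4, Dden]; ring

lemma Dden_pos {x : E4} (hx : -1 < x 3) : 0 < Dden x := by
  have : 0 < (x 3 + 1) ^ 2 := by nlinarith
  unfold Dden; positivity

lemma Lam_eq_inversion {x : E4} (hx : -1 < x 3) :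
    Lam x = EuclideanGeometry.inversion (-e4 3) (√2) x := by
  have hD := (Dden_pos hx).ne'
  have hdist : dist x (-e4 3) ^ 2 = Dden x := by
    rw [dist_eq_norm, norm_sq_e4, Dden]
    simp [e4]
  have h4 : ‖x‖ ^ 2 = Dden x - 2 * x 3 - 1 := by rw [Dden_eq]; ring
  rw [EuclideanGeometry.inversion, div_pow, hdist, Real.sq_sqrt zero_le_two, Lam, h4]
  simp only [vsub_eq_sub, sub_neg_eq_add, vadd_eq_add, smul_add, smul_smul, ← sub_eq_add_neg]
  match_scalars
  · field_simp
  · field_simp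
    ring

lemma Lam_apply_three {x : E4} : Lam x 3 = (1 - ‖x‖ ^ 2) / Dden x := by
  simp [Lam, e4]; ring

lemma one_sub_norm_sq_Lam {x : E4} (hx : -1 < x 3) :
    1 - ‖Lam x‖ ^ 2 = 4 * x 3 / Dden x := by
  have hD := (Dden_pos hx).ne'
  rw [norm_sq_e4, Lam_apply_three]
  simp only [Lam, e4, PiLp.smul_apply, PiLp.add_apply, smul_eq_mul, PiLp.single_apply]
  have h4 : Dden x = x 0 ^ 2 + x 1 ^ 2 + x 2 ^ 2 + x 3 ^ 2 + 2 * x 3 + 1 := by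
    rw [Dden]; ring
  rw [norm_sq_e4]
  simp
  field_simp
  rw [h4]
  ring

lemma norm_Lam_le_one_iff {x : E4} (hx : -1 < x 3) : ‖Lam x‖ ≤ 1 ↔ 0 ≤ x 3 := by
  have h := one_sub_norm_sq_Lam hx
  have hD := Dden_pos hx
  rw [eq_div_iff hD.ne'] at h
  rw [← sq_le_one_iff₀ (norm_nonneg _), ← sub_nonneg, ← mul_nonneg_iff_of_pos_right hD, h]
  constructor <;> intro <;> linarith

lemma norm_Lam_eq_one_iff {x : E4} (hx : -1 < x 3) : ‖Lam x‖ = 1 ↔ x 3 = 0 := by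
  have h := one_sub_norm_sq_Lam hx
  have hD := Dden_pos hx
  rw [← pow_eq_one_iff_of_nonneg (norm_nonneg _) two_ne_zero, ← sub_eq_zero, ← neg_eq_zero, neg_sub, h]
  simp [hD.ne']

lemma Lam_apply_three_nonneg_iff {x : E4} (hx : -1 < x 3) : 0 ≤ Lam x 3 ↔ ‖x‖ ≤ 1 := by
  rw [Lam_apply_three, le_div_iff₀ (Dden_pos hx), zero_mul, sub_nonneg,
    sq_le_one_iff₀ (norm_nonneg _)]

lemma Lam_apply_three_eq_zero_iff {x : E4} (hx : -1 < x 3) : Lam x 3 = 0 ↔ ‖x‖ = 1 := by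
  rw [Lam_apply_three, div_eq_zero_iff, or_iff_left (Dden_pos hx).ne', sub_eq_zero, eq_comm,
    pow_eq_one_iff_of_nonneg (norm_nonneg _) two_ne_zero]

lemma neg_one_lt_of_mem_B4p {x : E4} (hx : x ∈ B4p) : -1 < x 3 := by
  have := hx.2; linarith

lemma mapsTo_Lam_B4p : MapsTo Lam B4p B4p := fun _ hx =>
  ⟨(norm_Lam_le_one_iff (neg_one_lt_of_mem_B4p hx)).2 hx.2,
    (Lam_apply_three_nonneg_iff (neg_one_lt_of_mem_B4p hx)).2 hx.1⟩

lemma Lam_Lam {x : E4} (hx : x ∈ B4p) : Lam (Lam x) = x := by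
  rw [Lam_eq_inversion (neg_one_lt_of_mem_B4p (mapsTo_Lam_B4p hx)),
    Lam_eq_inversion (neg_one_lt_of_mem_B4p hx),
    EuclideanGeometry.inversion_inversion _ (by positivity)]

lemma Mhs_subset : Mhs ⊆ B4p := fun _ hx => ⟨hx.1.le, hx.2⟩

lemma Nfb_subset : Nfb ⊆ B4p := fun _ hx => ⟨hx.1, hx.2.ge⟩

lemma Sig_subset_Nfb : Sig ⊆ Nfb := fun _ hx => ⟨hx.1.le, hx.2⟩

lemma Sig_subset_Mhs : Sig ⊆ Mhs := fun _ hx => ⟨hx.1, hx.2.ge⟩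

lemma Sig_subset : Sig ⊆ B4p := Sig_subset_Nfb.trans Nfb_subset

/-- If `Lam` maps two parts of the half-ball into each other, it maps the first onto the
second. -/
lemma image_Lam_eq {S T : Set E4} (hT : T ⊆ B4p) (hST : MapsTo Lam S T) (hTS : MapsTo Lam T S) :
    Lam '' S = T :=
  hST.image_subset.antisymm fun y hy => ⟨Lam y, hTS hy, Lam_Lam (hT hy)⟩

lemma mapsTo_Lam_Nfb : MapsTo Lam Nfb Mhs := fun x hx => by
  have h := neg_one_lt_of_mem_B4p (Nfb_subset hx)
  exact ⟨(norm_Lam_eq_one_iff h).2 hx.2, (Lam_apply_three_nonneg_iff h).2 hx.1⟩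

lemma mapsTo_Lam_Mhs : MapsTo Lam Mhs Nfb := fun x hx => by
  have h := neg_one_lt_of_mem_B4p (Mhs_subset hx)
  exact ⟨(norm_Lam_le_one_iff h).2 hx.2, (Lam_apply_three_eq_zero_iff h).2 hx.1⟩

lemma mapsTo_Lam_Sig : MapsTo Lam Sig Sig := fun _ hx =>
  ⟨(mapsTo_Lam_Nfb (Sig_subset_Nfb hx)).1, (mapsTo_Lam_Mhs (Sig_subset_Mhs hx)).2⟩

lemma image_Lam_Nfb : Lam '' Nfb = Mhs := image_Lam_eq Mhs_subset mapsTo_Lam_Nfb mapsTo_Lam_Mhs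

lemma image_Lam_Mhs : Lam '' Mhs = Nfb := image_Lam_eq Nfb_subset mapsTo_Lam_Mhs mapsTo_Lam_Nfb

lemma isOpen_neg_one_lt : IsOpen {x : E4 | -1 < x 3} :=
  isOpen_lt continuous_const (by fun_prop)

lemma smoothNearHB_Lam : SmoothNearHB Lam := by
  refine ⟨_, isOpen_neg_one_lt, fun x hx => neg_one_lt_of_mem_B4p hx, ?_⟩
  refine ContDiffOn.congr (f := EuclideanGeometry.inversion (-e4 3) (√2)) ?_
    fun x hx => Lam_eq_inversion hx
  refine contDiffOn_const.inversion contDiffOn_const contDiffOn_id ?_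
  rintro x hx rfl
  simp [e4] at hx

lemma confMem_Lam : ConfMem Lam := by
  have hbij : BijOn Lam B4p B4p :=
    ⟨mapsTo_Lam_B4p, fun x hx y hy h => by rw [← Lam_Lam hx, h, Lam_Lam hy],
      fun y hy => ⟨Lam y, mapsTo_Lam_B4p hy, Lam_Lam hy⟩⟩
  refine ⟨hbij, smoothNearHB_Lam, ⟨Lam, smoothNearHB_Lam, hbij, fun x hx => Lam_Lam hx,
    fun x hx => Lam_Lam hx⟩, ?_, image_Lam_eq Sig_subset mapsTo_Lam_Sig mapsTo_Lam_Sig, ?_⟩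
  · rw [image_union, image_Lam_Nfb, image_Lam_Mhs, union_comm]
  · intro x hx
    have h := neg_one_lt_of_mem_B4p hx
    have hne : x ≠ -e4 3 := by
      rintro rfl
      simp [e4] at h
    have hev : Lam =ᶠ[𝓝 x] EuclideanGeometry.inversion (-e4 3) (√2) :=
      Filter.eventuallyEq_of_mem (isOpen_neg_one_lt.mem_nhds h) fun y hy => Lam_eq_inversion hy
    have hd := (EuclideanGeometry.hasFDerivAt_inversion (R := √2) hne).congr_of_eventuallyEq hev
    have hpos : 0 < dist x (-e4 3) := dist_pos.2 hne
    refine ⟨(√2 / dist x (-e4 3)) ^ 2, by positivity, fun v => ?_⟩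
    rw [hd.fderiv]
    simp [norm_smul, abs_of_nonneg (Real.sqrt_nonneg 2)]

/-! ### Group structure -/

lemma SmoothNearHB.differentiableAt {F : E4 → E4} (hF : SmoothNearHB F) {x : E4} (hx : x ∈ B4p) :
    DifferentiableAt ℝ F x := by
  obtain ⟨U, hU, hBU, hFU⟩ := hF
  exact (hFU.differentiableOn (by simp)).differentiableAt (hU.mem_nhds (hBU hx))

lemma SmoothNearHB.comp {F G : E4 → E4} (hF : SmoothNearHB F) (hG : SmoothNearHB G)
    (hmaps : MapsTo G B4p B4p) : SmoothNearHB (F ∘ G) := by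
  obtain ⟨U, hU, hBU, hFU⟩ := hF
  obtain ⟨V, hV, hBV, hGV⟩ := hG
  exact ⟨V ∩ G ⁻¹' U, hGV.continuousOn.isOpen_inter_preimage hV hU,
    fun x hx => ⟨hBV hx, hBU (hmaps hx)⟩,
    hFU.comp (hGV.mono inter_subset_left) fun x hx => hx.2⟩

lemma uniqueDiffOn_B4p : UniqueDiffOn ℝ B4p := by
  refine uniqueDiffOn_convex ?_ ?_
  · have h : B4p = Metric.closedBall 0 1 ∩ {x : E4 | 0 ≤ EuclideanSpace.proj (𝕜 := ℝ) 3 x} := by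
      ext x; simp [B4p]
    rw [h]
    exact (convex_closedBall _ _).inter
      (convex_halfSpace_ge (EuclideanSpace.proj (𝕜 := ℝ) (3 : Fin 4)).toLinearMap.isLinear 0)
  · have ho : IsOpen {x : E4 | ‖x‖ < 1 ∧ 0 < x 3} :=
      (isOpen_lt continuous_norm continuous_const).inter
        (isOpen_lt continuous_const (EuclideanSpace.proj (𝕜 := ℝ) (3 : Fin 4)).continuous)
    refine ⟨(2⁻¹ : ℝ) • e4 3, interior_maximal (fun x hx => And.intro hx.1.le hx.2.le) ho ?_⟩
    constructor
    · simp [norm_smul, e4]; norm_num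
    · simp [e4]

lemma ConfMem.comp {F G : E4 → E4} (hF : ConfMem F) (hG : ConfMem G) : ConfMem (F ∘ G) := by
  obtain ⟨bF, sF, ⟨F', sF', bF', lF, rF⟩, iF, jF, cF⟩ := hF
  obtain ⟨bG, sG, ⟨G', sG', bG', lG, rG⟩, iG, jG, cG⟩ := hG
  refine ⟨bF.comp bG, sF.comp sG bG.mapsTo,
    ⟨G' ∘ F', sG'.comp sF' bF'.mapsTo, bG'.comp bF', fun x hx => ?_, fun x hx => ?_⟩, ?_, ?_, ?_⟩
  · have h := lF (bG.mapsTo hx)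
    simp only [Function.comp_apply, id_eq] at h ⊢
    rw [h]; exact lG hx
  · have h := rG (bF'.mapsTo hx)
    simp only [Function.comp_apply, id_eq] at h ⊢
    rw [h]; exact rF hx
  · rw [image_comp, iG, iF]
  · rw [image_comp, jG, jF]
  · intro x hx
    obtain ⟨a, ha, hFa⟩ := cF (G x) (bG.mapsTo hx)
    obtain ⟨b, hb, hGb⟩ := cG x hx
    refine ⟨a * b, mul_pos ha hb, fun v => ?_⟩
    rw [fderiv_comp x (sF.differentiableAt (bG.mapsTo hx)) (sG.differentiableAt hx),
      ContinuousLinearMap.comp_apply, hFa, hGb, mul_assoc]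

lemma confMem_id : ConfMem id := by
  have hs : SmoothNearHB id := ⟨univ, isOpen_univ, subset_univ _, contDiffOn_id⟩
  exact ⟨bijOn_id _, hs, ⟨id, hs, bijOn_id _, fun _ _ => rfl, fun _ _ => rfl⟩, image_id _,
    image_id _, fun x _ => ⟨1, one_pos, fun v => by simp⟩⟩

/-- A left inverse on the half-ball moves images back. -/
lemma image_eq_of_leftInverse {F G : E4 → E4} (h : EqOn (G ∘ F) id B4p) {S T : Set E4}
    (hS : S ⊆ B4p) (hST : F '' S = T) : G '' T = S := by
  rw [← hST, ← image_comp, (h.mono hS).image_eq, image_id]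

lemma ConfMem.exists_inverse {F : E4 → E4} (hF : ConfMem F) :
    ∃ G : E4 → E4, ConfMem G ∧ EqOn (G ∘ F) id B4p ∧ EqOn (F ∘ G) id B4p := by
  obtain ⟨bF, sF, ⟨G, sG, bG, lF, rF⟩, iF, jF, cF⟩ := hF
  refine ⟨G, ⟨bG, sG, ⟨F, sF, bF, rF, lF⟩,
    image_eq_of_leftInverse lF (union_subset Mhs_subset Nfb_subset) iF,
    image_eq_of_leftInverse lF Sig_subset jF, fun x hx => ?_⟩, lF, rF⟩
  obtain ⟨a, ha, hFa⟩ := cF (G x) (bG.mapsTo hx)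
  refine ⟨a⁻¹, inv_pos.2 ha, fun v => ?_⟩
  have h₁ : HasFDerivWithinAt (F ∘ G) ((fderiv ℝ F (G x)).comp (fderiv ℝ G x)) B4p x :=
    ((sF.differentiableAt (bG.mapsTo hx)).hasFDerivAt.comp x
      (sG.differentiableAt hx).hasFDerivAt).hasFDerivWithinAt
  have h₂ : HasFDerivWithinAt (F ∘ G) (ContinuousLinearMap.id ℝ E4) B4p x :=
    (hasFDerivWithinAt_id x B4p).congr rF (rF hx)
  have h₃ := congrArg (fun L : E4 →L[ℝ] E4 => ‖L v‖) ((uniqueDiffOn_B4p x hx).eq h₁ h₂)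
  simp only [ContinuousLinearMap.comp_apply, hFa, ContinuousLinearMap.id_apply] at h₃
  rw [← h₃, inv_mul_cancel_left₀ ha.ne']

/-! ### Dichotomy for the boundary faces -/

lemma mem_Nfb_diff_Sig {x : E4} : x ∈ Nfb \ Sig ↔ ‖x‖ < 1 ∧ x 3 = 0 := by
  simp only [Nfb, Sig, mem_sdiff, mem_ofPred_eq, lt_iff_le_and_ne]
  tauto

lemma mem_Mhs_diff_Sig {x : E4} : x ∈ Mhs \ Sig ↔ ‖x‖ = 1 ∧ 0 < x 3 := by
  simp only [Mhs, Sig, mem_sdiff, mem_ofPred_eq, lt_iff_le_and_ne, ne_comm (a := (0 : ℝ))]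
  tauto

lemma ConfMem.image_diff_Sig {F : E4 → E4} (hF : ConfMem F) {S : Set E4} (hS : S ⊆ B4p) :
    F '' (S \ Sig) = F '' S \ Sig := by
  refine Subset.antisymm ?_ ?_
  · rintro _ ⟨x, ⟨hxS, hx⟩, rfl⟩
    refine ⟨mem_image_of_mem F hxS, fun h => hx ?_⟩
    rw [← hF.2.2.2.2.1, hF.1.injOn.mem_image_iff Sig_subset (hS hxS)] at h
    exact h
  · rintro _ ⟨⟨x, hxS, rfl⟩, hx⟩
    exact ⟨x, ⟨hxS, fun h => hx (hF.2.2.2.2.1.le (mem_image_of_mem F h))⟩, rfl⟩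

lemma ConfMem.continuousOn {F : E4 → E4} (hF : ConfMem F) : ContinuousOn F B4p := fun _ hx =>
  (hF.2.1.differentiableAt hx).continuousAt.continuousWithinAt

lemma isPreconnected_Nfb_diff_Sig : IsPreconnected (Nfb \ Sig) := by
  have h : Nfb \ Sig =
      Metric.ball 0 1 ∩ {x : E4 | EuclideanSpace.proj (𝕜 := ℝ) (3 : Fin 4) x = 0} := by
    ext x; rw [mem_Nfb_diff_Sig]; simp
  rw [h]
  exact ((convex_ball _ _).inter (convex_hyperplane
    (EuclideanSpace.proj (𝕜 := ℝ) (3 : Fin 4)).toLinearMap.isLinear 0)).isPreconnected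

lemma isPreconnected_Mhs_diff_Sig : IsPreconnected (Mhs \ Sig) := by
  rw [← image_Lam_Nfb, ← confMem_Lam.image_diff_Sig Nfb_subset]
  exact isPreconnected_Nfb_diff_Sig.image _
    (confMem_Lam.continuousOn.mono (sdiff_subset.trans Nfb_subset))

lemma subset_or_subset_of_isPreconnected {S : Set E4} (hS : IsPreconnected S)
    (h : S ⊆ (Mhs ∪ Nfb) \ Sig) : S ⊆ Mhs \ Sig ∨ S ⊆ Nfb \ Sig := by
  rw [union_sdiff_distrib] at h
  by_contra! hcon
  obtain ⟨⟨x, hxS, hx⟩, ⟨y, hyS, hy⟩⟩ := hcon.imp not_subset.1 not_subset.1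
  have hx' := mem_Nfb_diff_Sig.1 ((h hxS).resolve_left hx)
  have hy' := mem_Mhs_diff_Sig.1 ((h hyS).resolve_right hy)
  obtain ⟨z, hzS, hz₁, hz₂⟩ := hS {x | ‖x‖ < 1} {x | 0 < x 3}
    (isOpen_lt continuous_norm continuous_const) (isOpen_lt continuous_const (by fun_prop))
    (fun z hz => (h hz).symm.imp (fun h => (mem_Nfb_diff_Sig.1 h).1)
      fun h => (mem_Mhs_diff_Sig.1 h).2)
    ⟨x, hxS, hx'.1⟩ ⟨y, hyS, hy'.2⟩
  rcases h hzS with hz | hz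
  · exact hz₁.ne (mem_Mhs_diff_Sig.1 hz).1
  · exact hz₂.ne' (mem_Nfb_diff_Sig.1 hz).2

lemma e4_three_mem : e4 3 ∈ Mhs \ Sig := by
  rw [mem_Mhs_diff_Sig]; simp [e4]

lemma zero_mem_Nfb_diff_Sig : (0 : E4) ∈ Nfb \ Sig := by
  rw [mem_Nfb_diff_Sig]; simp

lemma disjoint_faces : Disjoint (Mhs \ Sig) (Nfb \ Sig) :=
  disjoint_left.2 fun _ h₁ h₂ => (mem_Nfb_diff_Sig.1 h₂).1.ne (mem_Mhs_diff_Sig.1 h₁).1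

lemma Nfb_ne_Mhs : Nfb ≠ Mhs := fun h => by
  have := zero_mem_Nfb_diff_Sig
  rw [h] at this
  exact disjoint_left.1 disjoint_faces this zero_mem_Nfb_diff_Sig

/-- If `A ∪ B = C ∪ D` with `C`, `D` disjoint, `A ⊆ C` and `B ⊆ D`, then `A = C` and `B = D`. -/
lemma eq_and_eq_of_union_eq {α : Type*} {A B C D : Set α} (h : A ∪ B = C ∪ D)
    (hCD : Disjoint C D) (hA : A ⊆ C) (hB : B ⊆ D) : A = C ∧ B = D := by
  refine ⟨hA.antisymm fun x hx => ?_, hB.antisymm fun x hx => ?_⟩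
  · exact (h.ge (Or.inl hx)).resolve_right fun hxB => disjoint_left.1 hCD hx (hB hxB)
  · exact (h.ge (Or.inr hx)).resolve_left fun hxA => disjoint_left.1 hCD (hA hxA) hx

lemma ConfMem.image_faces {F : E4 → E4} (hF : ConfMem F) :
    (F '' Nfb = Nfb ∧ F '' Mhs = Mhs) ∨ (F '' Nfb = Mhs ∧ F '' Mhs = Nfb) := by
  have hcN : ContinuousOn F (Nfb \ Sig) := hF.continuousOn.mono (sdiff_subset.trans Nfb_subset)
  have hcM : ContinuousOn F (Mhs \ Sig) := hF.continuousOn.mono (sdiff_subset.trans Mhs_subset)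
  have hU : F '' (Mhs \ Sig) ∪ F '' (Nfb \ Sig) = Mhs \ Sig ∪ Nfb \ Sig := by
    rw [← image_union, ← union_sdiff_distrib,
      hF.image_diff_Sig (union_subset Mhs_subset Nfb_subset), hF.2.2.2.1]
  have hU' := hU.le
  rw [← union_sdiff_distrib (s := Mhs)] at hU'
  have key : ∀ {S T : Set E4}, Sig ⊆ S → Sig ⊆ T → F '' (S \ Sig) = T \ Sig → F '' S = T := by
    intro S T hS hT h
    rw [← sdiff_union_of_subset hS, image_union, h, hF.2.2.2.2.1, sdiff_union_of_subset hT]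
  rcases subset_or_subset_of_isPreconnected (isPreconnected_Mhs_diff_Sig.image F hcM)
      (subset_union_left.trans hU') with hM | hM <;>
    rcases subset_or_subset_of_isPreconnected (isPreconnected_Nfb_diff_Sig.image F hcN)
      (subset_union_right.trans hU') with hN | hN
  · exact absurd zero_mem_Nfb_diff_Sig <| disjoint_left.1 disjoint_faces <|
      union_subset hM hN (hU.ge (Or.inr zero_mem_Nfb_diff_Sig))
  · obtain ⟨h₁, h₂⟩ := eq_and_eq_of_union_eq hU disjoint_faces hM hN
    exact Or.inl ⟨key Sig_subset_Nfb Sig_subset_Nfb h₂, key Sig_subset_Mhs Sig_subset_Mhs h₁⟩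
  · obtain ⟨h₁, h₂⟩ := eq_and_eq_of_union_eq (hU.trans (union_comm _ _)) disjoint_faces.symm hM hN
    exact Or.inr ⟨key Sig_subset_Nfb Sig_subset_Mhs h₂, key Sig_subset_Mhs Sig_subset_Nfb h₁⟩
  · exact absurd (union_subset hM hN (hU.ge (Or.inl e4_three_mem))) <|
      disjoint_left.1 disjoint_faces e4_three_mem

lemma ConfPlusMem.image_Mhs {F : E4 → E4} (hF : ConfPlusMem F) : F '' Mhs = Mhs :=
  hF.1.image_faces.elim And.right fun h => absurd (hF.2.symm.trans h.1) Nfb_ne_Mhs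

/-- Structure of the conformal group of the half-ball,
`Conf(B⁴₊) = Conf⁺(B⁴₊) ⋊ ⟨Λ⟩ ≅ Möb(S²) ⋊ ℤ₂`.  (Since elements of `Conf(B⁴₊)` are
encoded as globally defined functions, equality of group elements is equality on `B⁴₊`,
i.e. `Set.EqOn · · B4p`.)  The conjunction asserts: every `Ψ ∈ Conf(B⁴₊)` either fixes
`B³` as a set (and then also fixes `S³₊` as a set) or maps `B³` onto `S³₊`; `Conf⁺` is a
subgroup (contains the identity, is closed under composition, and has inverses in
`Conf⁺`); `Conf⁺` is normal in `Conf`; `Λ ∈ Conf(B⁴₊) \ Conf⁺(B⁴₊)` and `Λ` has order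
two; and `(Φ, n) ↦ Φ ∘ Λⁿ`, for `Φ ∈ Conf⁺` and `n ∈ {0,1}`, is a bijection onto
`Conf(B⁴₊)` — i.e. it is surjective (every `Ψ ∈ Conf` is of exactly one of the forms
`Φ` or `Φ ∘ Λ` with `Φ ∈ Conf⁺`) and injective (no `Φ₁ ∈ Conf⁺` equals some `Φ₂ ∘ Λ` on
`B⁴₊`, and `Φ₁ ∘ Λ = Φ₂ ∘ Λ` on `B⁴₊` forces `Φ₁ = Φ₂` on `B⁴₊`).  In particular
`Conf⁺(B⁴₊)` has index two in `Conf(B⁴₊)`. -/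
theorem stmt7 :
    -- dichotomy for the boundary faces
    (∀ Ψ : E4 → E4, ConfMem Ψ →
      (Ψ '' Nfb = Nfb ∧ Ψ '' Mhs = Mhs) ∨ Ψ '' Nfb = Mhs) ∧
    -- `Conf⁺` is a subgroup
    ConfPlusMem id ∧
    (∀ F G : E4 → E4, ConfPlusMem F → ConfPlusMem G → ConfPlusMem (F ∘ G)) ∧
    (∀ F : E4 → E4, ConfPlusMem F → ∃ G : E4 → E4, ConfPlusMem G ∧
      Set.EqOn (G ∘ F) id B4p ∧ Set.EqOn (F ∘ G) id B4p) ∧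
    -- `Conf⁺` is normal in `Conf`
    (∀ Ψ G : E4 → E4, ConfMem Ψ → ConfMem G → Set.EqOn (G ∘ Ψ) id B4p →
      ∀ F : E4 → E4, ConfPlusMem F → ConfPlusMem (G ∘ F ∘ Ψ)) ∧
    -- `Λ` generates a complementary subgroup of order two
    ConfMem Lam ∧ ¬ ConfPlusMem Lam ∧ Set.EqOn (Lam ∘ Lam) id B4p ∧
    -- surjectivity of `(Φ, n) ↦ Φ ∘ Λⁿ`
    (∀ Ψ : E4 → E4, ConfMem Ψ →
      ConfPlusMem Ψ ∨ ∃ F : E4 → E4, ConfPlusMem F ∧ Set.EqOn Ψ (F ∘ Lam) B4p) ∧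
    -- injectivity of `(Φ, n) ↦ Φ ∘ Λⁿ`
    (∀ F₁ F₂ : E4 → E4, ConfPlusMem F₁ → ConfPlusMem F₂ →
      ¬ Set.EqOn F₁ (F₂ ∘ Lam) B4p) ∧
    (∀ F₁ F₂ : E4 → E4, ConfPlusMem F₁ → ConfPlusMem F₂ →
      Set.EqOn (F₁ ∘ Lam) (F₂ ∘ Lam) B4p → Set.EqOn F₁ F₂ B4p) := by
  refine ⟨fun Ψ hΨ => hΨ.image_faces.imp_right And.left, ⟨confMem_id, image_id _⟩,
    fun F G hF hG => ⟨hF.1.comp hG.1, by rw [image_comp, hG.2, hF.2]⟩, fun F hF => ?_,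
    fun Ψ G hΨ hG hGΨ F hF => ⟨hG.comp (hF.1.comp hΨ), ?_⟩, confMem_Lam,
    fun h => Nfb_ne_Mhs (h.2.symm.trans image_Lam_Nfb), fun x hx => Lam_Lam hx,
    fun Ψ hΨ => ?_, fun F₁ F₂ h₁ h₂ h => Nfb_ne_Mhs ?_, fun F₁ F₂ _ _ h x hx => ?_⟩
  · obtain ⟨G, hG, hGF, hFG⟩ := hF.1.exists_inverse
    exact ⟨G, ⟨hG, image_eq_of_leftInverse hGF Nfb_subset hF.2⟩, hGF, hFG⟩
  · rw [image_comp, image_comp]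
    rcases hΨ.image_faces with h | h
    · rw [h.1, hF.2, image_eq_of_leftInverse hGΨ Nfb_subset h.1]
    · rw [h.1, hF.image_Mhs, image_eq_of_leftInverse hGΨ Nfb_subset h.1]
  · rcases hΨ.image_faces with h | h
    · exact Or.inl ⟨hΨ, h.1⟩
    · refine Or.inr ⟨Ψ ∘ Lam, ⟨hΨ.comp confMem_Lam, ?_⟩, fun x hx => ?_⟩
      · rw [image_comp, image_Lam_Nfb, h.2]
      · simp [Lam_Lam hx]
  · rw [← h₁.2, (h.mono Nfb_subset).image_eq, image_comp, image_Lam_Nfb, h₂.image_Mhs]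
  · simpa [Lam_Lam hx] using h (mapsTo_Lam_B4p hx)
end
end

section
/- For all integers j ≥ 0 and k ≥ 0, ∫₀^{π/2} sin((2k+2)φ) · sin((2j+1)φ) dφ = 2(−1)^{j+k}(k+1) / ((2k+2j+3)(2k−2j+1)). Consequently, with the normalized zonal harmonics f_m(φ) = sin((m+1)φ)/(π sin φ), the L² inner product over the upper half-sphere S³₊ satisfies ⟨f_{2k+1}, f_{2j}⟩_{L²(S³₊)} = 8(−1)^{j+k}(k+1) / (π(2k+2j+3)(2k−2j+1)), where ⟨f,g⟩_{L²(S³₊)} = 4π ∫₀^{π/2} f(φ) g(φ) sin²(φ) dφ for functions depending only on the polar angle φ. -/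
noncomputable section

open Real

theorem integral_sin_mul_mul_sin_mul {a b : ℝ} (h : a ^ 2 - b ^ 2 ≠ 0) (x : ℝ) :
    ∫ φ in (0 : ℝ)..x, Real.sin (a * φ) * Real.sin (b * φ) =
      (b * Real.sin (a * x) * Real.cos (b * x) - a * Real.cos (a * x) * Real.sin (b * x)) /
        (a ^ 2 - b ^ 2) := by
  have hlin (c φ : ℝ) : HasDerivAt (fun t : ℝ => c * t) c φ := by
    simpa using (hasDerivAt_id φ).const_mul c
  have hderiv (φ : ℝ) : HasDerivAt
      (fun t => (b * Real.sin (a * t) * Real.cos (b * t) -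
        a * Real.cos (a * t) * Real.sin (b * t)) / (a ^ 2 - b ^ 2))
      (Real.sin (a * φ) * Real.sin (b * φ)) φ := by
    refine (((((hlin a φ).sin.const_mul b).mul (hlin b φ).cos).sub
      (((hlin a φ).cos.const_mul a).mul (hlin b φ).sin)).div_const (a ^ 2 - b ^ 2)).congr_deriv ?_
    symm
    rw [eq_div_iff h]
    ring
  rw [intervalIntegral.integral_eq_sub_of_hasDerivAt (fun φ _ => hderiv φ)
    (Continuous.intervalIntegrable (by fun_prop) _ _)]
  simp

theorem integral_sin_even_mul_sin_odd (j k : ℕ) :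
    ∫ φ in (0 : ℝ)..(π/2),
        Real.sin ((2 * (k : ℝ) + 2) * φ) * Real.sin ((2 * (j : ℝ) + 1) * φ)
      = 2 * (-1 : ℝ) ^ (j + k) * ((k : ℝ) + 1) /
        ((2 * (k : ℝ) + 2 * (j : ℝ) + 3) * (2 * (k : ℝ) - 2 * (j : ℝ) + 1)) := by
  have hfactor : (2 * (k : ℝ) + 2) ^ 2 - (2 * (j : ℝ) + 1) ^ 2 =
      (2 * (k : ℝ) + 2 * (j : ℝ) + 3) * (2 * (k : ℝ) - 2 * (j : ℝ) + 1) := by ring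
  have hne : 2 * (k : ℝ) - 2 * (j : ℝ) + 1 ≠ 0 := by
    have : 2 * (k : ℤ) - 2 * (j : ℤ) + 1 ≠ 0 := by omega
    exact_mod_cast this
  have hpos : 2 * (k : ℝ) + 2 * (j : ℝ) + 3 ≠ 0 := by positivity
  have ha : (2 * (k : ℝ) + 2) * (π / 2) = ((k + 1 : ℕ) : ℝ) * π := by push_cast; ring
  have hb : (2 * (j : ℝ) + 1) * (π / 2) = (j : ℝ) * π + π / 2 := by ring
  rw [integral_sin_mul_mul_sin_mul (hfactor ▸ mul_ne_zero hpos hne), hfactor, ha, hb,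
    Real.sin_nat_mul_pi, Real.cos_nat_mul_pi, Real.sin_add_pi_div_two, Real.cos_nat_mul_pi]
  congr 1
  ring

/-- The basic integral identity
`∫₀^{π/2} sin((2k+2)φ) sin((2j+1)φ) dφ = 2(-1)^{j+k}(k+1)/((2k+2j+3)(2k-2j+1))`,
and consequently, with the normalized zonal harmonics `f_m(φ) = sin((m+1)φ)/(π sin φ)`
and the `L²(S³₊)` inner product `⟨f,g⟩ = 4π ∫₀^{π/2} f g sin² φ dφ` for zonal functions,
`⟨f_{2k+1}, f_{2j}⟩ = 8(-1)^{j+k}(k+1)/(π(2k+2j+3)(2k-2j+1))`. -/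
theorem stmt13 (j k : ℕ) :
    (∫ φ in (0 : ℝ)..(π/2),
        Real.sin ((2 * (k : ℝ) + 2) * φ) * Real.sin ((2 * (j : ℝ) + 1) * φ)
      = 2 * (-1 : ℝ) ^ (j + k) * ((k : ℝ) + 1) /
        ((2 * (k : ℝ) + 2 * (j : ℝ) + 3) * (2 * (k : ℝ) - 2 * (j : ℝ) + 1))) ∧
    (4 * π * ∫ φ in (0 : ℝ)..(π/2),
        (Real.sin ((2 * (k : ℝ) + 2) * φ) / (π * Real.sin φ)) *
          (Real.sin ((2 * (j : ℝ) + 1) * φ) / (π * Real.sin φ)) * (Real.sin φ) ^ 2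
      = 8 * (-1 : ℝ) ^ (j + k) * ((k : ℝ) + 1) /
        (π * (2 * (k : ℝ) + 2 * (j : ℝ) + 3) * (2 * (k : ℝ) - 2 * (j : ℝ) + 1))) := by
  refine ⟨integral_sin_even_mul_sin_odd j k, ?_⟩
  have hcongr : Set.EqOn
      (fun φ => (Real.sin ((2 * (k : ℝ) + 2) * φ) / (π * Real.sin φ)) *
        (Real.sin ((2 * (j : ℝ) + 1) * φ) / (π * Real.sin φ)) * (Real.sin φ) ^ 2)
      (fun φ => (π ^ 2)⁻¹ *
        (Real.sin ((2 * (k : ℝ) + 2) * φ) * Real.sin ((2 * (j : ℝ) + 1) * φ)))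
      (Set.uIcc 0 (π / 2)) := by
    intro φ hφ
    rw [Set.uIcc_of_le (by positivity)] at hφ
    rcases hφ.1.eq_or_lt with rfl | h0
    · simp
    · have hsin : Real.sin φ ≠ 0 :=
        (Real.sin_pos_of_pos_of_lt_pi h0 (by linarith [hφ.2, Real.pi_pos])).ne'
      simp only
      field_simp
  rw [intervalIntegral.integral_congr hcongr, intervalIntegral.integral_const_mul,
    integral_sin_even_mul_sin_odd, mul_assoc π, ← div_div _ π]
  field_simp
  ring
end
end

section
/- Let h : ℝ⁴ → ℝ be a harmonic polynomial (Δh = 0) that is homogeneous of degree k ≥ 0, and let F(x) := (k + 2 − k‖x‖²) h(x). Then on the unit sphere S³: the inward normal derivative vanishes, μ F(x) := −⟨∇F(x), x⟩ = 0 for all x ∈ S³; and P₃^{S³} F = 2k(k+1)(k+2) · h|_{S³}, i.e. (1/2)μ(ΔF) + Δ_{S³}(μF) − Δ_{S³}(F|_{S³}) = 2k(k+1)(k+2) h on S³. -/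
noncomputable section

open Real Set
open scoped RealInnerProductSpace Topology

/-- `h` is (the function associated to) a real polynomial in the four coordinates. -/
def IsPolyFun (h : E4 → ℝ) : Prop :=
  ∃ P : MvPolynomial (Fin 4) ℝ, ∀ x : E4, h x = MvPolynomial.eval (fun i => x i) P

lemma IsPolyFun.contDiff {h : E4 → ℝ} (hpoly : IsPolyFun h) : ContDiff ℝ 2 h := by
  obtain ⟨P, hP⟩ := hpoly
  rw [show h = fun x : E4 => MvPolynomial.eval (fun i => x i) P from funext hP]
  clear hP
  induction P using MvPolynomial.induction_on with
  | C a => simpa using contDiff_const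
  | add p q hp hq => simpa using hp.add hq
  | mul_X p i hp =>
    simp only [map_mul, MvPolynomial.eval_X]
    exact hp.mul (by fun_prop)

/-- Euler's identity for homogeneous functions. -/
lemma fderiv_apply_self_of_homogeneous {k : ℕ} {h : E4 → ℝ} {x : E4}
    (hd : DifferentiableAt ℝ h x) (hhom : ∀ (t : ℝ) (x : E4), h (t • x) = t ^ k * h x) :
    fderiv ℝ h x x = k * h x := by
  have h1 : HasDerivAt (fun t : ℝ => t • x) x 1 := by
    simpa using (hasDerivAt_id (1 : ℝ)).smul_const x
  have h2 : HasDerivAt (fun t : ℝ => h (t • x)) (fderiv ℝ h x x) 1 := by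
    have hd' : HasFDerivAt h (fderiv ℝ h x) ((1 : ℝ) • x) := by simpa using hd.hasFDerivAt
    exact hd'.comp_hasDerivAt 1 h1
  have h3 : HasDerivAt (fun t : ℝ => h (t • x)) (k * h x) 1 := by
    simp only [hhom]
    simpa using (hasDerivAt_pow k (1 : ℝ)).mul_const (h x)
  exact h2.unique h3

lemma inner_e4 (x : E4) (i : Fin 4) : ⟪x, e4 i⟫ = x i := by
  simp [e4, EuclideanSpace.inner_single_right]

lemma sum_smul_e4 (x : E4) : ∑ i, x i • e4 i = x := by
  ext j
  simp [e4, Pi.single_apply]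

lemma hasFDerivAt_comp_norm_sq {φ : ℝ → ℝ} {φ' : ℝ} {y : E4} (hφ : HasDerivAt φ φ' (‖y‖ ^ 2)) :
    HasFDerivAt (fun z : E4 => φ (‖z‖ ^ 2)) ((2 * φ') • innerSL ℝ y) y := by
  have := hφ.comp_hasFDerivAt y (hasStrictFDerivAt_norm_sq y).hasFDerivAt
  refine this.congr_fderiv ?_
  ext v
  simp
  ring

lemma fderiv_radial_mul {φ : ℝ → ℝ} {φ' : ℝ} {h : E4 → ℝ} {y : E4}
    (hφ : HasDerivAt φ φ' (‖y‖ ^ 2)) (hd : DifferentiableAt ℝ h y) (v : E4) :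
    fderiv ℝ (fun z => φ (‖z‖ ^ 2) * h z) y v
      = φ (‖y‖ ^ 2) * fderiv ℝ h y v + 2 * φ' * ⟪y, v⟫ * h y := by
  have := ((hasFDerivAt_comp_norm_sq hφ).mul hd.hasFDerivAt).fderiv
  change fderiv ℝ (fun z => φ (‖z‖ ^ 2) * h z) y = _ at this
  rw [this]
  simp
  ring

lemma lap_congr {u v : E4 → ℝ} {x : E4} (huv : u =ᶠ[𝓝 x] v) : lap u x = lap v x := by
  refine Finset.sum_congr rfl fun i _ => ?_
  have : (fun y => fderiv ℝ u y (e4 i)) =ᶠ[𝓝 x] fun y => fderiv ℝ v y (e4 i) :=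
    huv.fderiv.fun_comp (fun L : E4 →L[ℝ] ℝ => L (e4 i))
  rw [this.fderiv_eq]

/-- The Laplacian of a radial function times a homogeneous harmonic function on `ℝ⁴`. -/
lemma lap_radial_mul {k : ℕ} {h : E4 → ℝ} (hh : ContDiff ℝ 2 h) (hharm : ∀ x : E4, lap h x = 0)
    (hhom : ∀ (t : ℝ) (x : E4), h (t • x) = t ^ k * h x) {φ φ' φ'' : ℝ → ℝ}
    (hφ : ∀ s, 0 < s → HasDerivAt φ (φ' s) s) (hφ' : ∀ s, 0 < s → HasDerivAt φ' (φ'' s) s)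
    {x : E4} (hx : x ≠ 0) :
    lap (fun y => φ (‖y‖ ^ 2) * h y) x
      = (4 * φ'' (‖x‖ ^ 2) * ‖x‖ ^ 2 + (8 + 4 * k) * φ' (‖x‖ ^ 2)) * h x := by
  have hd : Differentiable ℝ h := hh.differentiable (by norm_num)
  have hpos : 0 < ‖x‖ ^ 2 := by positivity
  have hdd (v : E4) : Differentiable ℝ (fun y => fderiv ℝ h y v) :=
    ((hh.fderiv_right (m := 1) (by norm_num)).clm_apply contDiff_const).differentiable (by norm_num)
  have key (i : Fin 4) :
      fderiv ℝ (fun y => fderiv ℝ (fun z => φ (‖z‖ ^ 2) * h z) y (e4 i)) x (e4 i)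
        = φ (‖x‖ ^ 2) * fderiv ℝ (fun y => fderiv ℝ h y (e4 i)) x (e4 i)
          + 4 * φ' (‖x‖ ^ 2) * (x i * fderiv ℝ h x (e4 i))
          + 4 * φ'' (‖x‖ ^ 2) * h x * (x i) ^ 2 + 2 * φ' (‖x‖ ^ 2) * h x := by
    have hev : (fun y => fderiv ℝ (fun z => φ (‖z‖ ^ 2) * h z) y (e4 i)) =ᶠ[𝓝 x]
        fun y => φ (‖y‖ ^ 2) * fderiv ℝ h y (e4 i) + φ' (‖y‖ ^ 2) * (2 * ⟪y, e4 i⟫ * h y) := by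
      filter_upwards [isOpen_ne.mem_nhds hx] with y hy
      have hy' : 0 < ‖y‖ ^ 2 := by
        have : y ≠ 0 := hy
        positivity
      rw [fderiv_radial_mul (hφ _ hy') (hd y)]
      ring
    have hdi : HasFDerivAt (fun y : E4 => 2 * ⟪y, e4 i⟫ * h y)
        ((2 * ⟪x, e4 i⟫) • fderiv ℝ h x + h x • ((2 : ℝ) • innerSL ℝ (e4 i))) x := by
      have : HasFDerivAt (fun y : E4 => 2 * ⟪y, e4 i⟫) ((2 : ℝ) • innerSL ℝ (e4 i)) x := by
        simpa [real_inner_comm] using ((innerSL ℝ (e4 i)).hasFDerivAt (x := x)).const_mul 2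
      exact this.mul (hd x).hasFDerivAt
    have hprod := fderiv_radial_mul (hφ _ hpos) (hdd (e4 i) x) (e4 i)
    have hprod' := fderiv_radial_mul (hφ' _ hpos) hdi.differentiableAt (e4 i)
    rw [hev.fderiv_eq, fderiv_fun_add
      ((hasFDerivAt_comp_norm_sq (hφ _ hpos)).differentiableAt.fun_mul (hdd _ x))
      ((hasFDerivAt_comp_norm_sq (hφ' _ hpos)).differentiableAt.fun_mul hdi.differentiableAt),
      add_apply, hprod, hprod', hdi.fderiv]
    have hee : ⟪e4 i, e4 i⟫ = (1 : ℝ) := by rw [inner_e4]; simp [e4]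
    simp only [inner_e4, add_apply, smul_apply,
      innerSL_apply_apply, smul_eq_mul] at hee ⊢
    rw [hee]
    ring
  have hEuler : ∑ i, x i * fderiv ℝ h x (e4 i) = k * h x := by
    rw [← fderiv_apply_self_of_homogeneous (hd x) hhom]
    calc ∑ i, x i * fderiv ℝ h x (e4 i) = fderiv ℝ h x (∑ i, x i • e4 i) := by simp
      _ = fderiv ℝ h x x := by rw [sum_smul_e4]
  have hL : ∑ i, fderiv ℝ (fun y => fderiv ℝ h y (e4 i)) x (e4 i) = 0 := hharm x
  have hN : ∑ i, (x i) ^ 2 = ‖x‖ ^ 2 := (EuclideanSpace.real_norm_sq_eq x).symm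
  rw [lap, Finset.sum_congr rfl fun i _ => key i]
  simp only [Finset.sum_add_distrib, ← Finset.mul_sum, hL, hEuler, hN, Finset.sum_const,
    Finset.card_univ, Fintype.card_fin, nsmul_eq_mul]
  push_cast
  ring

/-- If `h` is a harmonic polynomial on `ℝ⁴`, homogeneous of degree `k`, and
`F(x) = (k + 2 - k‖x‖²) h(x)`, then on the unit sphere `μ F = 0` and
`P₃^{S³} F = 2k(k+1)(k+2) h`.  (Here `muM` is the inward normal derivative
`μ u (x) = -⟨∇u(x), x⟩`, and `P3M` is the operator
`P₃^{S³} u = (1/2)μ(Δu) + Δ_{S³}(μ u) - Δ_{S³}(u|_{S³})`.) -/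
theorem stmt17 (k : ℕ) (h : E4 → ℝ) (hpoly : IsPolyFun h)
    (hharm : ∀ x : E4, lap h x = 0)
    (hhom : ∀ (t : ℝ) (x : E4), h (t • x) = t ^ k * h x) :
    (∀ x : E4, ‖x‖ = 1 →
      muM (fun y => ((k : ℝ) + 2 - (k : ℝ) * ‖y‖ ^ 2) * h y) x = 0) ∧
    (∀ x : E4, ‖x‖ = 1 →
      P3M (fun y => ((k : ℝ) + 2 - (k : ℝ) * ‖y‖ ^ 2) * h y) x
        = 2 * (k : ℝ) * ((k : ℝ) + 1) * ((k : ℝ) + 2) * h x) := by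
  have hh := hpoly.contDiff
  have hd : Differentiable ℝ h := hh.differentiable (by norm_num)
  have hEuler (x : E4) : fderiv ℝ h x x = k * h x :=
    fderiv_apply_self_of_homogeneous (hd x) hhom
  have hφ (s : ℝ) : HasDerivAt (fun s : ℝ => (k : ℝ) + 2 - k * s) (-k) s := by
    simpa using ((hasDerivAt_id s).const_mul (k : ℝ)).const_sub ((k : ℝ) + 2)
  have hmu (x : E4) (hx : ‖x‖ = 1) :
      muM (fun y => ((k : ℝ) + 2 - (k : ℝ) * ‖y‖ ^ 2) * h y) x = 0 := by
    rw [muM, fderiv_radial_mul (hφ _) (hd x), hEuler, real_inner_self_eq_norm_sq, hx]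
    ring
  refine ⟨hmu, fun x hx => ?_⟩
  have hx0 : x ≠ 0 := norm_ne_zero_iff.mp (by simp [hx])
  have hne : ∀ᶠ y in 𝓝 x, y ≠ 0 := isOpen_ne.mem_nhds hx0
  have hunit {y : E4} (hy : y ≠ 0) : ‖‖y‖⁻¹ • y‖ = 1 := by
    simpa using norm_smul_inv_norm (𝕜 := ℝ) hy
  have hlap : muM (lap fun y => ((k : ℝ) + 2 - (k : ℝ) * ‖y‖ ^ 2) * h y) x
      = 4 * k ^ 2 * (k + 2) * h x := by
    have hev : lap (fun y => ((k : ℝ) + 2 - (k : ℝ) * ‖y‖ ^ 2) * h y) =ᶠ[𝓝 x]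
        fun y => ((8 + 4 * k) * -(k : ℝ)) * h y := by
      filter_upwards [hne] with y hy
      rw [lap_radial_mul hh hharm hhom (φ'' := fun _ => 0) (fun s _ => hφ s)
        (fun s _ => hasDerivAt_const s _) hy]
      ring
    rw [muM, hev.fderiv_eq, fderiv_const_mul (hd x), smul_apply, hEuler,
      smul_eq_mul]
    ring
  have hsph_mu : sphLap (muM fun y => ((k : ℝ) + 2 - (k : ℝ) * ‖y‖ ^ 2) * h y) x = 0 := by
    have hev : (fun y => muM (fun y => ((k : ℝ) + 2 - (k : ℝ) * ‖y‖ ^ 2) * h y) (‖y‖⁻¹ • y))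
        =ᶠ[𝓝 x] fun _ => 0 := by
      filter_upwards [hne] with y hy using hmu _ (hunit hy)
    rw [sphLap, lap_congr hev]
    simp [lap]
  have hsph : sphLap (fun y => ((k : ℝ) + 2 - (k : ℝ) * ‖y‖ ^ 2) * h y) x
      = -(2 * k * (k + 2)) * h x := by
    have hev : (fun y : E4 => ((k : ℝ) + 2 - (k : ℝ) * ‖‖y‖⁻¹ • y‖ ^ 2) * h (‖y‖⁻¹ • y))
        =ᶠ[𝓝 x] fun y => (2 * (‖y‖ ^ 2) ^ (-(k / 2) : ℝ)) * h y := by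
      filter_upwards [hne] with y hy
      have hpow : (‖y‖ ^ 2) ^ (-(k / 2) : ℝ) = ‖y‖⁻¹ ^ k := by
        rw [← Real.rpow_natCast ‖y‖ 2, ← Real.rpow_mul (norm_nonneg y), inv_pow,
          ← Real.rpow_natCast ‖y‖ k, ← Real.rpow_neg (norm_nonneg y)]
        congr 1
        push_cast
        ring
      rw [hunit hy, hhom, hpow]
      ring
    have hpow (c p : ℝ) (s : ℝ) (hs : 0 < s) :
        HasDerivAt (fun s : ℝ => c * s ^ p) (c * p * s ^ (p - 1)) s := by
      simpa [mul_assoc] using (Real.hasDerivAt_rpow_const (Or.inl hs.ne')).const_mul c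
    rw [sphLap, lap_congr hev, lap_radial_mul hh hharm hhom (hpow _ _) (hpow _ _) hx0, hx]
    simp only [one_pow, Real.one_rpow]
    ring
  rw [P3M, hlap, hsph_mu, hsph]
  ring
end
end
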